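/- For every t ≥ 1, the matching complex of the 1 × 1 × t honeycomb graph (a single row of t hexagons in which consecutive hexagons share one edge; equivalently the graph of t 6-gons in a line) is at least (t − 1)-connected. -/

import Mathlib

open SimpleGraph

/-- Two edges (as elements of `Sym2 V`) are incident if they share a vertex. -/
def EdgeIncident {V : Type*} (e f : Sym2 V) : Prop := ∃ v, v ∈ e ∧ v ∈ f

/-- The matching complex of a graph, as the set of its faces:
finite sets of pairwise non-incident edges of `G`. -/
def matchingComplex {V : Type*} (G : SimpleGraph V) : Set (Finset (Sym2 V)) :=
  {m | (∀ e ∈ m, e ∈ G.edgeSet) ∧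
    (m : Set (Sym2 V)).Pairwise fun e f => ¬ EdgeIncident e f}

/-- The geometric realization of an abstract simplicial complex, given as a
downward-closed set of finite subsets of the vertex type `α`. -/
abbrev Realization {α : Type*} (K : Set (Finset α)) : Type _ :=
  { f : α → ℝ // (∀ a, 0 ≤ f a) ∧
      ∃ s ∈ K, (∀ a, f a ≠ 0 → a ∈ s) ∧ ∑ a ∈ s, f a = 1 }

/-- A space `X` is `n`-connected if it is nonempty and all homotopy groups
`π_ℓ` vanish for `ℓ ≤ n`. -/
def IsNConnectedSpace (n : ℕ) (X : Type*) [TopologicalSpace X] : Prop :=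
  Nonempty X ∧ ∀ ℓ : ℕ, ℓ ≤ n → ∀ x : X, Subsingleton (HomotopyGroup (Fin ℓ) X x)

/-- The graph of `t` `2n`-gons in a line, realized on vertices in `ℤ × ℤ`.
For `n = 3` this is a single row of `t` hexagons in which consecutive hexagons share
exactly one (antipodal) edge, i.e. the `1 × 1 × t` honeycomb graph. -/
def polygonChain (n t : ℕ) : SimpleGraph (ℤ × ℤ) :=
  SimpleGraph.fromRel fun p q =>
    ((p.2 = 0 ∨ p.2 = 1) ∧ q.2 = p.2 ∧ q.1 = p.1 + 1 ∧
      0 ≤ p.1 ∧ p.1 < (t : ℤ) * ((n : ℤ) - 1)) ∨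
    (p.2 = 0 ∧ q.2 = 1 ∧ q.1 = p.1 ∧ (((n : ℤ) - 1) ∣ p.1) ∧
      0 ≤ p.1 ∧ p.1 ≤ (t : ℤ) * ((n : ℤ) - 1))

/-- A compact subset of `ℝᵐ` each of whose points has fewer than `n` coordinates outside some fixed
countable set of reals; such a set has covering dimension less than `n`. -/
def DimLT (n : ℕ) {m : ℕ} (Z : Set (Fin m → ℝ)) : Prop :=
  IsCompact Z ∧ ∃ F : Set ℝ, F.Countable ∧ ∀ z ∈ Z, {i | z i ∉ F}.ncard < n

lemma DimLT.mono {n m : ℕ} {Z Z' : Set (Fin m → ℝ)} (h : DimLT n Z) (hZ' : IsClosed Z')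
    (hsub : Z' ⊆ Z) : DimLT n Z' := by
  obtain ⟨hZ, F, hF, h⟩ := h
  exact ⟨hZ.of_isClosed_subset hZ' hsub, F, hF, fun z hz => h z (hsub hz)⟩

lemma DimLT.succ {n m : ℕ} {Z : Set (Fin m → ℝ)} (h : DimLT n Z) : DimLT (n + 1) Z := by
  obtain ⟨hZ, F, hF, h⟩ := h
  exact ⟨hZ, F, hF, fun z hz => (h z hz).trans (Nat.lt_succ_self n)⟩

lemma dimLT_of_isCompact {n m : ℕ} (hmn : m < n) {Z : Set (Fin m → ℝ)} (hZ : IsCompact Z) :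
    DimLT n Z :=
  ⟨hZ, ∅, Set.countable_empty, fun z _ => (Set.ncard_le_card _).trans_lt (by simpa using hmn)⟩

lemma exists_box_nhd {m : ℕ} {F : Set ℝ} (hF : F.Countable) (x : Fin m → ℝ)
    {V : Set (Fin m → ℝ)} (hV : IsOpen V) (hx : x ∈ V) :
    ∃ U, IsOpen U ∧ x ∈ U ∧ closure U ⊆ V ∧
      ∃ G : Set ℝ, G.Countable ∧ Disjoint G F ∧ ∀ z ∈ frontier U, ∃ i, z i ∈ G := by
  obtain ⟨ε, hε, hball⟩ := Metric.isOpen_iff.1 hV x hx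
  have hd := hF.dense_compl ℝ
  choose a haF ha using fun i => hd.exists_between (show x i - ε / 2 < x i by linarith)
  choose b hbF hb using fun i => hd.exists_between (show x i < x i + ε / 2 by linarith)
  have hcl : closure (Set.univ.pi fun i => Set.Ioo (a i) (b i)) =
      Set.univ.pi fun i => Set.Icc (a i) (b i) := by
    rw [closure_pi_set]
    congr 1
    ext1 i
    exact closure_Ioo ((ha i).2.trans (hb i).1).ne
  have hop : IsOpen (Set.univ.pi fun i => Set.Ioo (a i) (b i)) :=
    isOpen_set_pi Set.finite_univ fun i _ => isOpen_Ioo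
  refine ⟨Set.univ.pi fun i => Set.Ioo (a i) (b i), hop,
    fun i _ => ⟨(ha i).2, (hb i).1⟩, ?_, Set.range a ∪ Set.range b,
    (Set.countable_range a).union (Set.countable_range b), ?_, ?_⟩
  · rw [hcl]
    intro z hz
    apply hball
    rw [Metric.mem_ball, dist_pi_lt_iff hε]
    intro i
    have h1 := hz i trivial
    have h2 := (ha i).1
    have h3 := (hb i).2
    rw [Real.dist_eq, abs_lt]
    constructor <;> linarith [h1.1, h1.2]
  · rw [Set.disjoint_left]
    rintro _ (⟨i, rfl⟩ | ⟨i, rfl⟩)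
    exacts [haF i, hbF i]
  · intro z hz
    rw [hop.frontier_eq, hcl] at hz
    obtain ⟨hz1, hz2⟩ := hz
    by_contra! hcon
    refine hz2 fun i _ => ⟨lt_of_le_of_ne (hz1 i trivial).1 ?_, lt_of_le_of_ne (hz1 i trivial).2 ?_⟩
    · exact fun h => hcon i (Or.inl ⟨i, h⟩)
    · exact fun h => hcon i (Or.inr ⟨i, h.symm⟩)

lemma exists_separating_nhd {m : ℕ} {F : Set ℝ} (hF : F.Countable) {C V : Set (Fin m → ℝ)}
    (hC : IsCompact C) (hV : IsOpen V) (hCV : C ⊆ V) :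
    ∃ U, IsOpen U ∧ C ⊆ U ∧ closure U ⊆ V ∧
      ∃ G : Set ℝ, G.Countable ∧ Disjoint G F ∧ ∀ z ∈ frontier U, ∃ i, z i ∈ G := by
  refine hC.induction_on (p := fun C => ∃ U, IsOpen U ∧ C ⊆ U ∧ closure U ⊆ V ∧
      ∃ G : Set ℝ, G.Countable ∧ Disjoint G F ∧ ∀ z ∈ frontier U, ∃ i, z i ∈ G) ?_ ?_ ?_ ?_
  · exact ⟨∅, isOpen_empty, by simp, by simp, ∅, by simp⟩
  · rintro s t hst ⟨U, hU, hsU, h⟩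
    exact ⟨U, hU, hst.trans hsU, h⟩
  · rintro s t ⟨U, hU, hsU, hUV, G, hG, hGF, h⟩ ⟨U', hU', hsU', hUV', G', hG', hGF', h'⟩
    refine ⟨U ∪ U', hU.union hU', Set.union_subset_union hsU hsU', ?_, G ∪ G', hG.union hG',
      Set.disjoint_union_left.2 ⟨hGF, hGF'⟩, ?_⟩
    · rw [closure_union]
      exact Set.union_subset hUV hUV'
    · intro z hz
      rcases frontier_union_subset _ _ hz with hz | hz
      · exact (h z hz.1).imp fun i hi => Or.inl hi
      · exact (h' z hz.2).imp fun i hi => Or.inr hi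
  · intro x hx
    obtain ⟨U, hU, hxU, h⟩ := exists_box_nhd hF x hV (hCV hx)
    exact ⟨U, mem_nhdsWithin_of_mem_nhds (hU.mem_nhds hxU), U, hU, subset_rfl, h⟩

lemma DimLT.exists_partition {n m : ℕ} {Z C D : Set (Fin m → ℝ)} (h : DimLT (n + 1) Z)
    (hC : IsClosed C) (hD : IsClosed D) (hCZ : C ⊆ Z) (hCD : Disjoint C D) :
    ∃ P Q, IsClosed P ∧ IsClosed Q ∧ P ∪ Q = Z ∧ Disjoint P D ∧ Disjoint Q C ∧
      DimLT n (P ∩ Q) := by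
  obtain ⟨hZ, F, hF, h⟩ := h
  obtain ⟨U, hU, hCU, hUD, G, hG, hGF, hfr⟩ := exists_separating_nhd hF
    (hZ.of_isClosed_subset hC hCZ) hD.isOpen_compl (Set.subset_compl_iff_disjoint_right.2 hCD)
  have hP : IsClosed (Z ∩ closure U) := hZ.isClosed.inter isClosed_closure
  have hQ : IsClosed (Z ∩ Uᶜ) := hZ.isClosed.inter hU.isClosed_compl
  refine ⟨Z ∩ closure U, Z ∩ Uᶜ, hP, hQ, ?_, ?_, ?_,
    hZ.of_isClosed_subset (hP.inter hQ) fun z hz => hz.1.1, F ∪ G, hF.union hG, ?_⟩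
  · ext z
    have := @subset_closure _ _ U z
    simp only [Set.mem_union, Set.mem_inter_iff, Set.mem_compl_iff]
    tauto
  · exact Set.disjoint_left.2 fun z hz => hUD hz.2
  · exact Set.disjoint_left.2 fun z hz hzC => hz.2 (hCU hzC)
  · rintro z ⟨⟨hzZ, hzU⟩, -, hzU'⟩
    obtain ⟨i, hi⟩ := hfr z (hU.frontier_eq ▸ ⟨hzU, hzU'⟩)
    have hlt : {i | z i ∉ F ∪ G} ⊂ {i | z i ∉ F} := by
      have hsub : {i | z i ∉ F ∪ G} ⊆ {i | z i ∉ F} :=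
        fun j (hj : z j ∉ F ∪ G) hjF => hj (Or.inl hjF)
      exact (Set.ssubset_iff_of_subset hsub).2
        ⟨i, Set.disjoint_left.1 hGF hi, fun hcon => hcon (Or.inr hi)⟩
    have := Set.ncard_lt_ncard hlt (Set.toFinite _)
    have := h z hzZ
    omega

/-- Continuous maps into `S` from closed subsets of spaces of dimension less than `n` extend. -/
def ExtendsBelow (n : ℕ) {T : Type*} [TopologicalSpace T] (S : Set T) : Prop :=
  ∀ (m : ℕ) (Z Y : Set (Fin m → ℝ)), DimLT n Z → IsClosed Y → Y ⊆ Z →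
    ∀ f : (Fin m → ℝ) → T, ContinuousOn f Y → Set.MapsTo f Y S →
      ∃ g : (Fin m → ℝ) → T, ContinuousOn g Z ∧ Set.MapsTo g Z S ∧ Set.EqOn g f Y

section ExtendsBelow

variable {T : Type*} [TopologicalSpace T] {n : ℕ} {S A B : Set T}

lemma extendsBelow_zero (S : Set T) : ExtendsBelow 0 S := by
  rintro m Z Y ⟨-, F, -, hZ⟩ hY hYZ f hf hfS
  have hZ' : ∀ z, z ∉ Z := fun z hz => absurd (hZ z hz) (Nat.not_lt_zero _)
  exact ⟨f, fun z hz => absurd hz (hZ' z), fun z hz => absurd hz (hZ' z), fun z _ => rfl⟩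

lemma ExtendsBelow.of_succ (h : ExtendsBelow (n + 1) S) : ExtendsBelow n S :=
  fun m Z Y hZ => h m Z Y hZ.succ

open Classical in
lemma exists_glue {X : Type*} [TopologicalSpace X] {P Q : Set X} (hP : IsClosed P)
    (hQ : IsClosed Q) {f g : X → T} (hf : ContinuousOn f P) (hg : ContinuousOn g Q)
    (hfg : Set.EqOn f g (P ∩ Q)) :
    ∃ h : X → T, ContinuousOn h (P ∪ Q) ∧ Set.EqOn h f P ∧ Set.EqOn h g Q := by
  have hP' : Set.EqOn (P.piecewise f g) f P := Set.piecewise_eqOn _ _ _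
  have hQ' : Set.EqOn (P.piecewise f g) g Q := by
    intro x hx
    by_cases hxP : x ∈ P
    · rw [hP' hxP, hfg ⟨hxP, hx⟩]
    · simp [hxP]
  exact ⟨_, (hf.congr hP').union_of_isClosed (hg.congr hQ') hP hQ, hP', hQ'⟩

lemma ExtendsBelow.union (hA : IsOpen A) (hB : IsOpen B) (hEA : ExtendsBelow (n + 1) A)
    (hEB : ExtendsBelow (n + 1) B) (hEAB : ExtendsBelow n (A ∩ B)) :
    ExtendsBelow (n + 1) (A ∪ B) := by
  intro m Z Y hZ hY hYZ f hf hfS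
  have hC : IsClosed (Y ∩ f ⁻¹' Bᶜ) := hf.preimage_isClosed_of_isClosed hY hB.isClosed_compl
  have hD : IsClosed (Y ∩ f ⁻¹' Aᶜ) := hf.preimage_isClosed_of_isClosed hY hA.isClosed_compl
  obtain ⟨P, Q, hP, hQ, rfl, hPD, hQC, hdim⟩ := hZ.exists_partition hC hD
    (Set.inter_subset_left.trans hYZ) (by
      rw [Set.disjoint_left]
      rintro z ⟨hz, hzB⟩ ⟨-, hzA⟩
      exact (hfS hz).elim hzA hzB)
  have hfP : Set.MapsTo f (Y ∩ P) A := fun z hz => by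
    by_contra hcon
    exact Set.disjoint_left.1 hPD hz.2 ⟨hz.1, hcon⟩
  have hfQ : Set.MapsTo f (Y ∩ Q) B := fun z hz => by
    by_contra hcon
    exact Set.disjoint_left.1 hQC hz.2 ⟨hz.1, hcon⟩
  obtain ⟨g, hg, hgS, hgf⟩ := hEAB m (P ∩ Q) (Y ∩ (P ∩ Q)) hdim (hY.inter (hP.inter hQ))
    Set.inter_subset_right f (hf.mono Set.inter_subset_left)
    fun z hz => ⟨hfP ⟨hz.1, hz.2.1⟩, hfQ ⟨hz.1, hz.2.2⟩⟩
  obtain ⟨h, hh, hhf, hhg⟩ := exists_glue hY (hP.inter hQ) hf hg hgf.symm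
  obtain ⟨u, hu, huA, huh⟩ := hEA m P ((Y ∩ P) ∪ (P ∩ Q)) (hZ.mono hP Set.subset_union_left)
    ((hY.inter hP).union (hP.inter hQ)) (by
      rintro z (hz | hz)
      exacts [hz.2, hz.1]) h (hh.mono (Set.union_subset_union_left _ Set.inter_subset_left)) (by
      rintro z (hz | hz)
      · rw [hhf hz.1]
        exact hfP hz
      · rw [hhg hz]
        exact (hgS hz).1)
  obtain ⟨v, hv, hvB, hvh⟩ := hEB m Q ((Y ∩ Q) ∪ (P ∩ Q)) (hZ.mono hQ Set.subset_union_right)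
    ((hY.inter hQ).union (hP.inter hQ)) (by
      rintro z (hz | hz)
      exacts [hz.2, hz.2]) h (hh.mono (Set.union_subset_union_left _ Set.inter_subset_left)) (by
      rintro z (hz | hz)
      · rw [hhf hz.1]
        exact hfQ hz
      · rw [hhg hz]
        exact (hgS hz).2)
  obtain ⟨w, hw, hwu, hwv⟩ := exists_glue hP hQ hu hv
    fun z hz => (huh (Or.inr hz)).trans (hvh (Or.inr hz)).symm
  refine ⟨w, hw, ?_, fun z hz => ?_⟩
  · rintro z (hz | hz)
    · rw [hwu hz]
      exact Or.inl (huA hz)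
    · rw [hwv hz]
      exact Or.inr (hvB hz)
  · rcases hYZ hz with hz' | hz'
    · rw [hwu hz', huh (Or.inl ⟨hz, hz'⟩), hhf hz]
    · rw [hwv hz', hvh (Or.inl ⟨hz, hz'⟩), hhf hz]

end ExtendsBelow

lemma exists_continuous_extension_mem {X : Type*} [TopologicalSpace X] [NormalSpace X]
    {Y : Set X} (hY : IsClosed Y) {f : X → ℝ} (hf : ContinuousOn f Y) {t : Set ℝ}
    [t.OrdConnected] (ht : t.Nonempty) (hft : Set.MapsTo f Y t) :
    ∃ g : X → ℝ, Continuous g ∧ (∀ x, g x ∈ t) ∧ Set.EqOn g f Y := by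
  obtain ⟨g, hg, hgf⟩ := ContinuousMap.exists_restrict_eq_forall_mem_of_closed
    ⟨Y.domRestrict f, hf.domRestrict⟩ (t := t) (fun x => hft x.2) ht hY
  exact ⟨g, g.continuous, hg, fun y hy => DFunLike.congr_fun hgf ⟨y, hy⟩⟩

/-- An open thickening of the realization of the complex of those subsets of `E` that are
independent for `r`, where `W` is an ambient finite set of vertices. -/
def indNhd {β : Type*} (r : β → β → Prop) (W : Finset β) (E : Finset β) : Set (β → ℝ) :=
  {x | 0 < ∑ v ∈ W, x v ∧ (∀ v ∈ W, 0 ≤ x v → v ∈ E) ∧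
    ∀ u ∈ W, ∀ v ∈ W, 0 ≤ x u → 0 ≤ x v → u ≠ v → ¬ r u v}

section indNhd

variable {β : Type*} {r : β → β → Prop} {W E E' : Finset β} {n : ℕ}

lemma isOpen_indNhd : IsOpen (indNhd r W E) := by
  have h1 : ∀ v : β, IsOpen {x : β → ℝ | x v < 0} := fun v =>
    isOpen_lt (continuous_apply v) continuous_const
  have : indNhd r W E = {x | 0 < ∑ v ∈ W, x v} ∩
      ((⋂ v ∈ W, {x | x v < 0} ∪ {_x | v ∈ E}) ∩
      ⋂ u ∈ W, ⋂ v ∈ W, ({x | x u < 0} ∪ {x | x v < 0}) ∪ {_x | u ≠ v → ¬ r u v}) := by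
    ext x
    simp only [indNhd, Set.mem_ofPred_eq, Set.mem_inter_iff, Set.mem_iInter, Set.mem_union]
    refine and_congr_right fun _ => and_congr ?_ ?_
    · refine forall₂_congr fun v _ => ?_
      rw [← not_le, or_iff_not_imp_left, not_not]
    · refine forall₂_congr fun u _ => forall₂_congr fun v _ => ?_
      rw [← not_le, ← not_le]
      tauto
  rw [this]
  refine (isOpen_lt continuous_const (by fun_prop)).inter (IsOpen.inter ?_ ?_)
  · exact isOpen_biInter_finset fun v _ => (h1 v).union isOpen_const
  · exact isOpen_biInter_finset fun u _ => isOpen_biInter_finset fun v _ =>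
      ((h1 u).union (h1 v)).union isOpen_const

lemma indNhd_mono (h : E ⊆ E') : indNhd r W E ⊆ indNhd r W E' :=
  fun _ hx => ⟨hx.1, fun v hv hv0 => h (hx.2.1 v hv hv0), hx.2.2⟩

lemma indNhd_inter [DecidableEq β] :
    indNhd r W E ∩ indNhd r W E' = indNhd r W (E ∩ E') := by
  ext x
  simp only [indNhd, Set.mem_inter_iff, Set.mem_ofPred_eq, Finset.mem_inter]
  grind

lemma indNhd_eq_union [DecidableEq β] [DecidableRel r] (E : Finset β) (e : β) :
    indNhd r W E = indNhd r W (E.erase e) ∪ indNhd r W (E.filter fun v => v = e ∨ ¬ r e v) := by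
  apply Set.Subset.antisymm
  · intro x hx
    by_cases he : e ∈ W ∧ 0 ≤ x e
    · refine Or.inr ⟨hx.1, fun v hv hv0 => Finset.mem_filter.2 ⟨hx.2.1 v hv hv0, ?_⟩, hx.2.2⟩
      rw [or_iff_not_imp_left]
      exact fun hve => hx.2.2 e he.1 v hv he.2 hv0 (Ne.symm hve)
    · refine Or.inl ⟨hx.1, fun v hv hv0 => Finset.mem_erase.2 ⟨?_, hx.2.1 v hv hv0⟩, hx.2.2⟩
      rintro rfl
      exact he ⟨hv, hv0⟩
  · exact Set.union_subset (indNhd_mono (Finset.erase_subset _ _))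
      (indNhd_mono (Finset.filter_subset _ _))

lemma extendsBelow_indNhd_of_star [DecidableEq β] [DecidableRel r] (e : β)
    (h1 : ExtendsBelow (n + 1) (indNhd r W (E.erase e)))
    (h2 : ExtendsBelow (n + 1) (indNhd r W (E.filter fun v => v = e ∨ ¬ r e v)))
    (h3 : ExtendsBelow n (indNhd r W (E.filter fun v => v ≠ e ∧ ¬ r e v))) :
    ExtendsBelow (n + 1) (indNhd r W E) := by
  rw [indNhd_eq_union E e]
  refine ExtendsBelow.union isOpen_indNhd isOpen_indNhd h1 h2 ?_
  rw [indNhd_inter]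
  convert h3 using 2
  ext v
  simp only [Finset.mem_inter, Finset.mem_erase, Finset.mem_filter]
  tauto

lemma extendsBelow_indNhd_of_independent [DecidableEq β] {u : β} (huW : u ∈ W) (huE : u ∈ E)
    (hE : ∀ e ∈ E, ∀ f ∈ E, e ≠ f → ¬ r e f) : ExtendsBelow n (indNhd r W E) := by
  intro m Z Y _ hY _ f hf hfS
  have hext : ∀ v, ∃ g : (Fin m → ℝ) → ℝ, Continuous g ∧ (v ∈ W → v ∉ E → ∀ z, g z < 0) ∧
      Set.EqOn g (fun z => f z v) Y := by
    intro v
    have hfv : ContinuousOn (fun z => f z v) Y := (continuous_apply v).comp_continuousOn hf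
    by_cases hv : v ∈ W ∧ v ∉ E
    · obtain ⟨g, hg, hgt, hgf⟩ := exists_continuous_extension_mem hY hfv (t := Set.Iio 0)
        ⟨-1, by simp⟩ fun z hz => by
          by_contra hcon
          exact hv.2 ((hfS hz).2.1 v hv.1 (not_lt.1 hcon))
      exact ⟨g, hg, fun _ _ => hgt, hgf⟩
    · obtain ⟨g, hg, -, hgf⟩ := exists_continuous_extension_mem hY hfv (t := Set.univ)
        ⟨0, trivial⟩ fun _ _ => trivial
      exact ⟨g, hg, fun h h' => absurd ⟨h, h'⟩ hv, hgf⟩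
  choose g hg hgneg hgf using hext
  obtain ⟨s, hs, hspos, hsf⟩ := exists_continuous_extension_mem hY
    (f := fun z => ∑ v ∈ W, f z v)
    (continuousOn_finsetSum _ fun v _ => (continuous_apply v).comp_continuousOn hf)
    (t := Set.Ioi 0) ⟨1, by simp⟩ fun z hz => (hfS hz).1
  refine ⟨fun z v => if v = u then s z - ∑ w ∈ W.erase u, g w z else g v z, ?_, ?_, ?_⟩
  · refine (continuous_pi fun v => ?_).continuousOn
    split_ifs
    · exact hs.sub (continuous_finsetSum _ fun w _ => hg w)
    · exact hg v
  · intro z _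
    have hmem : ∀ v ∈ W, 0 ≤ (if v = u then s z - ∑ w ∈ W.erase u, g w z else g v z) → v ∈ E := by
      intro v hv hv0
      by_contra hvE
      rw [if_neg (by rintro rfl; exact hvE huE)] at hv0
      exact absurd (hgneg v hv hvE z) (not_lt.2 hv0)
    refine ⟨?_, hmem, fun v hv w hw hv0 hw0 => hE v (hmem v hv hv0) w (hmem w hw hw0)⟩
    beta_reduce
    rw [← Finset.add_sum_erase _ _ huW, if_pos rfl,
      Finset.sum_congr rfl fun w hw => if_neg (Finset.ne_of_mem_erase hw), sub_add_cancel]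
    exact hspos z
  · intro z hz
    ext v
    by_cases hv : v = u
    · subst hv
      simp only [if_true]
      rw [hsf hz, Finset.sum_congr rfl fun w _ => hgf w hz]
      beta_reduce
      rw [← Finset.add_sum_erase _ _ huW, add_sub_cancel_right]
    · simp only [if_neg hv]
      exact hgf v hz

lemma extendsBelow_indNhd_of_isolated [DecidableEq β] (hr : ∀ u v, r u v → r v u)
    {u : β} (huW : u ∈ W)
    (huE : u ∈ E) (hu : ∀ v ∈ E, v ≠ u → ¬ r u v) (n : ℕ) : ExtendsBelow n (indNhd r W E) := by
  classical
  induction hk : E.card using Nat.strong_induction_on generalizing E n with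
  | _ k ih =>
    subst hk
    by_cases hE : ∀ e ∈ E, ∀ f ∈ E, e ≠ f → ¬ r e f
    · exact extendsBelow_indNhd_of_independent huW huE hE
    push Not at hE
    obtain ⟨e, he, f, hf, hef, href⟩ := hE
    have heu : u ≠ e := by
      rintro rfl
      exact hu f hf hef.symm href
    have hue : ¬ r e u := fun h => hu e he heu.symm (hr _ _ h)
    cases n with
    | zero => exact extendsBelow_zero _
    | succ n =>
      refine extendsBelow_indNhd_of_star e (ih _ (Finset.card_erase_lt_of_mem he) ?_ ?_ _ rfl)
        (ih _ (Finset.card_lt_card ?_) ?_ ?_ _ rfl) (ih _ (Finset.card_lt_card ?_) ?_ ?_ _ rfl)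
      · exact Finset.mem_erase.2 ⟨heu, huE⟩
      · exact fun v hv => hu v (Finset.mem_of_mem_erase hv)
      · exact Finset.filter_ssubset.2 ⟨f, hf, by simp [hef.symm, href]⟩
      · exact Finset.mem_filter.2 ⟨huE, Or.inr hue⟩
      · exact fun v hv => hu v (Finset.mem_of_mem_filter _ hv)
      · exact Finset.filter_ssubset.2 ⟨e, he, by simp⟩
      · exact Finset.mem_filter.2 ⟨huE, heu, hue⟩
      · exact fun v hv => hu v (Finset.mem_of_mem_filter _ hv)

/-- Deletion and link of a vertex bound the connectivity of an independence complex. -/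
lemma extendsBelow_indNhd_of_delete_link [DecidableEq β] [DecidableRel r]
    (hr : ∀ u v, r u v → r v u)
    {e : β} (heW : e ∈ W) (heE : e ∈ E)
    (h1 : ExtendsBelow (n + 1) (indNhd r W (E.erase e)))
    (h2 : ExtendsBelow n (indNhd r W (E.filter fun v => v ≠ e ∧ ¬ r e v))) :
    ExtendsBelow (n + 1) (indNhd r W E) := by
  refine extendsBelow_indNhd_of_star e h1 (extendsBelow_indNhd_of_isolated hr heW ?_ ?_ _) h2
  · exact Finset.mem_filter.2 ⟨heE, Or.inl rfl⟩
  · intro v hv hve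
    exact (Finset.mem_filter.1 hv).2.resolve_left hve

lemma extendsBelow_indNhd_of_pendant [DecidableEq β] [DecidableRel r] (hr : ∀ u v, r u v → r v u)
    {u e : β} (huW : u ∈ W) (huE : u ∈ E) (heW : e ∈ W) (heE : e ∈ E) (hue : u ≠ e)
    (hu : ∀ v ∈ E, v ≠ u → v ≠ e → ¬ r u v)
    (h : ExtendsBelow n (indNhd r W (E.filter fun v => v ≠ e ∧ ¬ r e v))) :
    ExtendsBelow (n + 1) (indNhd r W E) := by
  refine extendsBelow_indNhd_of_delete_link hr heW heE
    (extendsBelow_indNhd_of_isolated hr huW (Finset.mem_erase.2 ⟨hue, huE⟩) ?_ _) h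
  intro v hv hvu
  exact hu v (Finset.mem_of_mem_erase hv) hvu (Finset.ne_of_mem_erase hv)

end indNhd

/-- Incidence of edges of a row of hexagons, where `(x, 0)` and `(x, 1)` encode the horizontal edges
starting at `x` in the two rows and `(x, 2)` encodes the vertical edge at `x`. -/
def rowIncident (e f : ℤ × ℤ) : Prop :=
  (e.2 = f.2 ∧ e.2 < 2 ∧ -1 ≤ e.1 - f.1 ∧ e.1 - f.1 ≤ 1) ∨
  (e.2 = 2 ∧ f.2 < 2 ∧ (f.1 = e.1 ∨ f.1 = e.1 - 1)) ∨
  (e.2 < 2 ∧ f.2 = 2 ∧ (e.1 = f.1 ∨ e.1 = f.1 - 1)) ∨ e = f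

instance : DecidableRel rowIncident := fun _ _ => by
  unfold rowIncident
  infer_instance

lemma rowIncident_symm (e f : ℤ × ℤ) (h : rowIncident e f) : rowIncident f e := by
  obtain ⟨a, b⟩ := e
  obtain ⟨c, d⟩ := f
  simp only [rowIncident, Prod.mk.injEq] at *
  omega

/-- The edges of a row of `s` hexagons. -/
noncomputable def rowEdges (s : ℕ) : Finset (ℤ × ℤ) :=
  (Finset.Icc 0 (2 * (s : ℤ)) ×ˢ Finset.Icc 0 2).filter fun e =>
    (e.2 = 2 ∧ e.1 % 2 = 0) ∨ (e.2 < 2 ∧ e.1 < 2 * s)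

lemma mem_rowEdges {s : ℕ} {x k : ℤ} : (x, k) ∈ rowEdges s ↔
    (k = 2 ∧ x % 2 = 0 ∧ 0 ≤ x ∧ x ≤ 2 * s) ∨ (0 ≤ k ∧ k < 2 ∧ 0 ≤ x ∧ x < 2 * s) := by
  simp only [rowEdges, Finset.mem_filter, Finset.mem_product, Finset.mem_Icc]
  omega

/-- The edges of a row of `s` hexagons with two additional pendant edges at its right end. -/
noncomputable def tailedRowEdges (s : ℕ) : Finset (ℤ × ℤ) :=
  rowEdges s ∪ {(2 * (s : ℤ), 0), (2 * (s : ℤ), 1)}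

lemma mem_tailedRowEdges {s : ℕ} {x k : ℤ} : (x, k) ∈ tailedRowEdges s ↔
    (k = 2 ∧ x % 2 = 0 ∧ 0 ≤ x ∧ x ≤ 2 * s) ∨ (0 ≤ k ∧ k < 2 ∧ 0 ≤ x ∧ x ≤ 2 * s) := by
  simp only [tailedRowEdges, Finset.mem_union, mem_rowEdges, Finset.mem_insert,
    Finset.mem_singleton, Prod.mk.injEq]
  omega

lemma extendsBelow_rowEdges_zero {W : Finset (ℤ × ℤ)} (hW : rowEdges 0 ⊆ W) (n : ℕ) :
    ExtendsBelow n (indNhd rowIncident W (rowEdges 0)) := by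
  have h : ((0, 2) : ℤ × ℤ) ∈ rowEdges 0 := by simp [mem_rowEdges]
  refine extendsBelow_indNhd_of_isolated rowIncident_symm (hW h) h ?_ n
  rintro ⟨x, k⟩ hv hne
  simp only [mem_rowEdges, rowIncident, Prod.mk.injEq, ne_eq] at *
  omega

lemma extendsBelow_tailedRowEdges_zero {W : Finset (ℤ × ℤ)} (hW : tailedRowEdges 0 ⊆ W) :
    ExtendsBelow 1 (indNhd rowIncident W (tailedRowEdges 0)) := by
  have h0 : ((0, 0) : ℤ × ℤ) ∈ tailedRowEdges 0 := by simp [mem_tailedRowEdges]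
  have h2 : ((0, 2) : ℤ × ℤ) ∈ tailedRowEdges 0 := by simp [mem_tailedRowEdges]
  refine extendsBelow_indNhd_of_pendant rowIncident_symm (hW h0) h0 (hW h2) h2 (by simp) ?_
    (extendsBelow_zero _)
  rintro ⟨x, k⟩ hv hne hne'
  simp only [mem_tailedRowEdges, rowIncident, Prod.mk.injEq, ne_eq] at *
  omega

/-- Deletion of the last rung of a row, followed by two pendant reductions at `(a, k)`, `k = 0, 1`,
with leaves `(a + 1, k)`. -/
lemma extendsBelow_of_last_rung {W E E₁ E₂ : Finset (ℤ × ℤ)} (hW : E ⊆ W) {n : ℕ} {a b : ℤ}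
    (hb : (b, 2) ∈ E)
    (h₀ : ∀ k, 0 ≤ k → k < 2 → (a, k) ∈ E ∧ (a + 1, k) ∈ E ∧ (a + 2, k) ∉ E)
    (hab : ∀ x, (x, 2) ∈ E → x ≠ b → x ≠ a + 1 ∧ x ≠ a + 2)
    (hE : ∀ x k, (x, k) ∈ E → 0 ≤ k ∧ k ≤ 2)
    (h₁ : ∀ x k, (x, k) ∈ E₁ ↔ (x, k) ∈ E ∧ (x, k) ≠ (b, 2) ∧ ¬ rowIncident (b, 2) (x, k))
    (h₂ : ∀ x k, (x, k) ∈ E₂ ↔ (x, k) ∈ E ∧ (x, k) ≠ (b, 2) ∧ ¬ rowIncident (a, 0) (x, k) ∧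
      ¬ rowIncident (a, 1) (x, k))
    (hE₁ : ExtendsBelow (n + 1) (indNhd rowIncident W E₁))
    (hE₂ : ExtendsBelow n (indNhd rowIncident W E₂)) :
    ExtendsBelow (n + 2) (indNhd rowIncident W E) := by
  obtain ⟨ha0, hl0, hn0⟩ := h₀ 0 (by norm_num) (by norm_num)
  obtain ⟨ha1, hl1, hn1⟩ := h₀ 1 (by norm_num) (by norm_num)
  refine extendsBelow_indNhd_of_delete_link rowIncident_symm (hW hb) hb ?_ ?_
  · refine extendsBelow_indNhd_of_pendant rowIncident_symm (u := (a + 1, 0)) (e := (a, 0))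
      (hW hl0) ?_ (hW ha0) ?_ (by simp) ?_ ?_
    · simp [hl0]
    · simp [ha0]
    · rintro ⟨x, k⟩ hv hne hne' hr
      rw [Finset.mem_erase] at hv
      have := hE x k hv.2
      have := hab x
      have h3 : x = a + 2 → k ≠ 0 := by
        rintro rfl rfl
        exact hn0 hv.2
      have h4 : k = 2 → (x, 2) ∈ E := fun h => h ▸ hv.2
      simp only [rowIncident, Prod.mk.injEq, ne_eq] at *
      grind
    · refine extendsBelow_indNhd_of_pendant rowIncident_symm (u := (a + 1, 1)) (e := (a, 1))
        (hW hl1) ?_ (hW ha1) ?_ (by simp) ?_ ?_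
      · simp [hl1, rowIncident]
      · simp [ha1, rowIncident]
      · rintro ⟨x, k⟩ hv hne hne' hr
        rw [Finset.mem_filter, Finset.mem_erase] at hv
        have := hE x k hv.1.2
        have := hab x
        have h3 : x = a + 2 → k ≠ 1 := by
          rintro rfl rfl
          exact hn1 hv.1.2
        have h4 : k = 2 → (x, 2) ∈ E := fun h => h ▸ hv.1.2
        simp only [rowIncident, Prod.mk.injEq, ne_eq] at *
        grind
      · convert hE₂ using 2
        ext ⟨x, k⟩
        simp only [Finset.mem_filter, Finset.mem_erase, h₂]
        have hself : ∀ e, rowIncident e e := fun e => by simp [rowIncident]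
        have h5 : (x, k) = (a, 0) → rowIncident (a, 0) (x, k) := fun h => h ▸ hself _
        have h6 : (x, k) = (a, 1) → rowIncident (a, 1) (x, k) := fun h => h ▸ hself _
        tauto
  · convert hE₁ using 2
    ext ⟨x, k⟩
    simp only [Finset.mem_filter, h₁]

lemma extendsBelow_rowEdges {t : ℕ} (s : ℕ) :
    (s ≤ t → ExtendsBelow (s + 1) (indNhd rowIncident (rowEdges t) (rowEdges s))) ∧
    (s < t → ExtendsBelow (s + 1) (indNhd rowIncident (rowEdges t) (tailedRowEdges s))) := by
  have hsub : ∀ {s}, s ≤ t → rowEdges s ⊆ rowEdges t := by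
    rintro s hs ⟨x, k⟩
    simp only [mem_rowEdges]
    omega
  have hsub' : ∀ {s}, s < t → tailedRowEdges s ⊆ rowEdges t := by
    rintro s hs ⟨x, k⟩
    simp only [mem_rowEdges, mem_tailedRowEdges]
    omega
  induction s using Nat.strong_induction_on with
  | _ s ih =>
    obtain _ | s := s
    · exact ⟨fun h => extendsBelow_rowEdges_zero (hsub h) _,
        fun h => extendsBelow_tailedRowEdges_zero (hsub' h)⟩
    refine ⟨fun h => ?_, fun h => ?_⟩
    · have h₁ := (ih s (by omega)).2 (by omega)
      have h₂ : ExtendsBelow s (indNhd rowIncident (rowEdges t)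
          ((tailedRowEdges (s - 1)).filter fun _ => 1 ≤ s)) := by
        obtain _ | s := s
        · exact extendsBelow_zero _
        · simpa using (ih s (by omega)).2 (by omega)
      refine extendsBelow_of_last_rung (hsub h) (a := 2 * s) (b := 2 * s + 2) ?_ ?_ ?_ ?_ ?_ ?_ h₁ h₂
      all_goals
        simp only [Finset.mem_filter, mem_rowEdges, mem_tailedRowEdges, rowIncident,
          Prod.mk.injEq, ne_eq]
        grind
    · have h₁ := (ih s (by omega)).2 (by omega)
      have h₂ := ((ih s (by omega)).1 (by omega)).of_succ
      refine extendsBelow_of_last_rung (hsub' h) (a := 2 * s + 1) (b := 2 * s + 2)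
        ?_ ?_ ?_ ?_ ?_ ?_ h₁ h₂
      all_goals
        simp only [mem_rowEdges, mem_tailedRowEdges, rowIncident, Prod.mk.injEq, ne_eq]
        grind

section Connected

variable {T X : Type*} [TopologicalSpace T] [TopologicalSpace X] {n : ℕ} {S O : Set T}

/-- If a space is a retract, through a homotopy `H` into `O`, of a set into which maps from spaces
of dimension `m` extend, then maps from the sphere of dimension `m - 1` extend to the ball. -/
lemma ExtendsBelow.exists_extension_closedBall {m : ℕ} (hS : ExtendsBelow n S) (hmn : m < n)
    (hSO : S ⊆ O) {ρ : O → X} (hρ : Continuous ρ) {H : X × ℝ → T} (hH : Continuous H)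
    (hHO : ∀ x, ∀ τ ∈ Set.Icc (0 : ℝ) 1, H (x, τ) ∈ O) (hHS : ∀ x, H (x, 1) ∈ S)
    (hρH : ∀ x (h : H (x, 0) ∈ O), ρ ⟨H (x, 0), h⟩ = x)
    {f : (Fin m → ℝ) → X} (hf : ContinuousOn f (Metric.sphere 0 1)) :
    ∃ F : C(Metric.closedBall (0 : Fin m → ℝ) 1, X),
      ∀ p : Metric.closedBall (0 : Fin m → ℝ) 1, ‖(p : Fin m → ℝ)‖ = 1 → F p = f p := by
  obtain ⟨g, hg, hgS, hgf⟩ := hS m (Metric.closedBall 0 1) (Metric.sphere 0 1)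
    (dimLT_of_isCompact hmn (isCompact_closedBall _ _)) Metric.isClosed_sphere
    Metric.sphere_subset_closedBall (fun p => H (f p, 1))
    (hH.comp_continuousOn (hf.prodMk continuousOn_const)) fun p _ => hHS _
  have hP : IsClosed {p : Fin m → ℝ | ‖p‖ ≤ 1 / 2} := isClosed_le continuous_norm continuous_const
  have hQ : IsClosed {p : Fin m → ℝ | 1 / 2 ≤ ‖p‖} := isClosed_le continuous_const continuous_norm
  have hsphere : ∀ p : Fin m → ℝ, 1 / 2 ≤ ‖p‖ → ‖p‖⁻¹ • p ∈ Metric.sphere (0 : Fin m → ℝ) 1 := by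
    intro p hp
    rw [mem_sphere_zero_iff_norm, norm_smul, norm_inv, norm_norm, inv_mul_cancel₀]
    linarith
  have hball : ∀ p : Fin m → ℝ, ‖p‖ ≤ 1 / 2 → (2 : ℝ) • p ∈ Metric.closedBall (0 : Fin m → ℝ) 1 := by
    intro p hp
    rw [mem_closedBall_zero_iff, norm_smul, Real.norm_two]
    linarith
  obtain ⟨h, hh, hhP, hhQ⟩ := exists_glue hP hQ
    (f := fun p => g ((2 : ℝ) • p)) (g := fun p => H (f (‖p‖⁻¹ • p), 2 - 2 * ‖p‖))
    (hg.comp (by fun_prop) hball)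
    (hH.comp_continuousOn (ContinuousOn.prodMk (hf.comp (ContinuousOn.smul
      (continuous_norm.continuousOn.inv₀ fun p (hp : 1 / 2 ≤ ‖p‖) => by linarith) continuousOn_id)
      hsphere) (by fun_prop))) (by
    rintro p ⟨hp1, hp2⟩
    have hp : ‖p‖ = 1 / 2 := le_antisymm hp1 hp2
    have h2 : ‖p‖⁻¹ • p = (2 : ℝ) • p := by rw [hp]; norm_num
    have := hgf (hsphere p hp2)
    rw [h2] at this
    beta_reduce
    rw [this, h2, hp]
    norm_num)
  have huniv : {p : Fin m → ℝ | ‖p‖ ≤ 1 / 2} ∪ {p | 1 / 2 ≤ ‖p‖} = Set.univ :=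
    Set.eq_univ_of_forall fun p => le_total ‖p‖ (1 / 2)
  rw [huniv, continuousOn_univ] at hh
  have hhO : ∀ p ∈ Metric.closedBall (0 : Fin m → ℝ) 1, h p ∈ O := by
    intro p hp
    rw [mem_closedBall_zero_iff] at hp
    rcases le_total ‖p‖ (1 / 2) with hp' | hp'
    · rw [hhP hp']
      exact hSO (hgS (hball p hp'))
    · rw [hhQ hp']
      exact hHO _ _ ⟨by linarith, by linarith⟩
  refine ⟨⟨fun p => ρ ⟨h p, hhO p p.2⟩, hρ.comp ?_⟩, fun p hp => ?_⟩
  · exact (hh.comp continuous_subtype_val).subtype_mk _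
  · have hhp : h p = H (f p, 0) := by
      rw [hhQ (show (1 / 2 : ℝ) ≤ ‖(p : Fin m → ℝ)‖ by rw [hp]; norm_num)]
      beta_reduce
      rw [hp, inv_one, one_smul]
      norm_num
    have := hρH (f p) (hhp ▸ hhO p p.2)
    simp only [ContinuousMap.coe_mk, hhp, this]

lemma exists_abs_eq_one_of_norm_eq_one {m : ℕ} {p : Fin m → ℝ} (hp : ‖p‖ = 1) :
    ∃ i, |p i| = 1 := by
  by_contra! h
  refine ((pi_norm_lt_iff zero_lt_one).2 fun i => lt_of_le_of_ne ?_ (h i)).ne hp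
  exact hp ▸ norm_le_pi_norm p i

/-- Vanishing of a homotopy group follows from extension of maps from spheres to balls. -/
lemma subsingleton_homotopyGroup {ℓ : ℕ}
    (hX : ∀ f : (Fin (ℓ + 1) → ℝ) → X, ContinuousOn f (Metric.sphere 0 1) →
      ∃ F : C(Metric.closedBall (0 : Fin (ℓ + 1) → ℝ) 1, X),
        ∀ p : Metric.closedBall (0 : Fin (ℓ + 1) → ℝ) 1, ‖(p : Fin (ℓ + 1) → ℝ)‖ = 1 → F p = f p)
    (x : X) :
    Subsingleton (HomotopyGroup (Fin ℓ) X x) := by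
  classical
  refine ⟨fun a b => ?_⟩
  induction a using Quotient.inductionOn with | _ f
  induction b using Quotient.inductionOn with | _ g
  apply Quotient.sound
  let y : (Fin (ℓ + 1) → ℝ) → (Fin ℓ → unitInterval) := fun p i =>
    Set.projIcc 0 1 zero_le_one ((p i.succ + 1) / 2)
  have hy : Continuous y := continuous_pi fun i => continuous_projIcc.comp (by fun_prop)
  have hybd : ∀ p : Fin (ℓ + 1) → ℝ, (∃ i : Fin ℓ, |p i.succ| = 1) →
      y p ∈ Cube.boundary (Fin ℓ) := by
    rintro p ⟨i, hi⟩
    refine ⟨i, ?_⟩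
    rcases (abs_eq zero_le_one).1 hi with h | h
    · right
      simp only [y, h]
      norm_num
    · left
      simp only [y, h]
      norm_num
  let φ : (Fin (ℓ + 1) → ℝ) → X := fun p =>
    if p 0 = -1 then f (y p) else if p 0 = 1 then g (y p) else x
  have hφf : ∀ p, p 0 = -1 → φ p = f (y p) := fun p hp => if_pos hp
  have hφg : ∀ p, p 0 = 1 → φ p = g (y p) := fun p hp => by
    simp only [φ, hp]
    norm_num
  have hφx : ∀ p, (∃ i : Fin ℓ, |p i.succ| = 1) → φ p = x := by
    intro p hp
    simp only [φ]
    split_ifs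
    exacts [f.2 _ (hybd p hp), g.2 _ (hybd p hp), rfl]
  have hφ : ContinuousOn φ (Metric.sphere 0 1) := by
    have h0 : Continuous fun p : Fin (ℓ + 1) → ℝ => p 0 := continuous_apply 0
    have hA : IsClosed {p : Fin (ℓ + 1) → ℝ | p 0 = -1} := isClosed_eq h0 continuous_const
    have hB : IsClosed {p : Fin (ℓ + 1) → ℝ | p 0 = 1} := isClosed_eq h0 continuous_const
    have hC : IsClosed {p : Fin (ℓ + 1) → ℝ | ∃ i : Fin ℓ, |p i.succ| = 1} := by
      have : {p : Fin (ℓ + 1) → ℝ | ∃ i : Fin ℓ, |p i.succ| = 1} =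
          ⋃ i : Fin ℓ, {p | |p i.succ| = 1} := by
        ext p
        simp
      rw [this]
      exact isClosed_iUnion_of_finite fun i =>
        isClosed_eq (continuous_apply i.succ).abs continuous_const
    have hf : ContinuousOn φ {p | p 0 = -1} := ((map_continuous f.1).comp hy).continuousOn.congr hφf
    have hg : ContinuousOn φ {p | p 0 = 1} := ((map_continuous g.1).comp hy).continuousOn.congr hφg
    have hx : ContinuousOn φ {p | ∃ i : Fin ℓ, |p i.succ| = 1} :=
      (continuousOn_const (c := x)).congr hφx
    refine ((hf.union_of_isClosed hg hA hB).union_of_isClosed hx (hA.union hB) hC).mono ?_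
    intro p hp
    obtain ⟨i, hi⟩ := exists_abs_eq_one_of_norm_eq_one (mem_sphere_zero_iff_norm.1 hp)
    induction i using Fin.cases with
    | zero => exact Or.inl (((abs_eq zero_le_one).1 hi).symm)
    | succ i => exact Or.inr ⟨i, hi⟩
  obtain ⟨F, hF⟩ := hX φ hφ
  let q : unitInterval × (Fin ℓ → unitInterval) → (Fin (ℓ + 1) → ℝ) := fun z =>
    Fin.cons (2 * (z.1 : ℝ) - 1) fun i => 2 * (z.2 i : ℝ) - 1
  have hqc : Continuous q := by
    refine continuous_pi fun i => ?_
    induction i using Fin.cases with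
    | zero => simp only [q, Fin.cons_zero]; fun_prop
    | succ i => simp only [q, Fin.cons_succ]; fun_prop
  have habs : ∀ s : unitInterval, |2 * (s : ℝ) - 1| ≤ 1 := fun s =>
    abs_le.2 ⟨by linarith [s.2.1], by linarith [s.2.2]⟩
  have hqi : ∀ z i, |q z i| ≤ 1 := by
    intro z i
    induction i using Fin.cases with
    | zero => exact habs _
    | succ i => exact habs _
  have hqb : ∀ z, q z ∈ Metric.closedBall (0 : Fin (ℓ + 1) → ℝ) 1 := fun z =>
    mem_closedBall_zero_iff.2 ((pi_norm_le_iff_of_nonneg zero_le_one).2 (hqi z))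
  have hq1 : ∀ z i, |q z i| = 1 → ‖q z‖ = 1 := fun z i hi =>
    le_antisymm (mem_closedBall_zero_iff.1 (hqb z)) (hi ▸ norm_le_pi_norm (q z) i)
  have hyq : ∀ z, y (q z) = z.2 := by
    intro z
    ext1 i
    have : (q z i.succ + 1) / 2 = z.2 i := by simp [q]
    simp only [y, this, Set.projIcc_val]
  have h0 : ∀ w, q (0, w) 0 = -1 := fun w => by simp [q]
  have h1 : ∀ w, q (1, w) 0 = 1 := fun w => by simp only [q, Fin.cons_zero]; norm_num
  refine ⟨⟨⟨⟨fun z => F ⟨q z, hqb z⟩, F.continuous.comp (hqc.subtype_mk _)⟩, ?_, ?_⟩, ?_⟩⟩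
  · intro w
    have := hF ⟨q (0, w), hqb _⟩ (hq1 _ 0 (by rw [h0]; norm_num))
    rw [hφf _ (h0 w), hyq] at this
    exact this
  · intro w
    have := hF ⟨q (1, w), hqb _⟩ (hq1 _ 0 (by rw [h1]; norm_num))
    rw [hφg _ (h1 w), hyq] at this
    exact this
  · intro s w hw
    obtain ⟨i, hi⟩ := hw
    have hi' : |q (s, w) i.succ| = 1 := by
      rcases hi with hi | hi <;> simp only [q, Fin.cons_succ, hi] <;> norm_num
    have := hF ⟨q (s, w), hqb _⟩ (hq1 _ i.succ hi')
    rw [hφx _ ⟨i, hi'⟩] at this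
    exact this.trans (f.2 w ⟨i, hi⟩).symm

lemma ExtendsBelow.isNConnectedSpace (hS : ExtendsBelow (n + 2) S)
    (hSO : S ⊆ O) {ρ : O → X} (hρ : Continuous ρ) {H : X × ℝ → T} (hH : Continuous H)
    (hHO : ∀ x, ∀ τ ∈ Set.Icc (0 : ℝ) 1, H (x, τ) ∈ O) (hHS : ∀ x, H (x, 1) ∈ S)
    (hρH : ∀ x (h : H (x, 0) ∈ O), ρ ⟨H (x, 0), h⟩ = x) [Nonempty T] : IsNConnectedSpace n X := by
  refine ⟨?_, fun ℓ hℓ x => subsingleton_homotopyGroup (fun f hf =>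
    hS.exists_extension_closedBall (by omega) hSO hρ hH hHO hHS hρH hf) x⟩
  obtain ⟨g, -, hgS, -⟩ := hS 0 {0} ∅ (dimLT_of_isCompact (by omega) isCompact_singleton)
    isClosed_empty (Set.empty_subset _) (fun _ => Classical.arbitrary T) (continuousOn_empty _)
    (Set.mapsTo_empty _ _)
  exact ⟨ρ ⟨g 0, hSO (hgS rfl)⟩⟩

end Connected

lemma isNConnectedSpace_realization {α β : Type*} {φ : β → α} {r : β → β → Prop} {W : Finset β}
    {n : ℕ} {K : Set (Finset α)} (hφ : Set.InjOn φ W)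
    (hK : ∀ s, s ∈ K ↔ (∀ a ∈ s, ∃ b ∈ W, φ b = a) ∧
      ∀ u ∈ W, ∀ v ∈ W, φ u ∈ s → φ v ∈ s → u ≠ v → ¬ r u v)
    (h : ExtendsBelow (n + 2) (indNhd r W W)) : IsNConnectedSpace n (Realization K) := by
  classical
  let O : Set (β → ℝ) := {x | 0 < ∑ v ∈ W, max (x v) 0 ∧
    ∀ u ∈ W, ∀ v ∈ W, 0 < x u → 0 < x v → u ≠ v → ¬ r u v}
  have hle : ∀ x : β → ℝ, ∑ v ∈ W, x v ≤ ∑ v ∈ W, max (x v) 0 := fun x =>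
    Finset.sum_le_sum fun v _ => le_max_left _ _
  have hSO : indNhd r W W ⊆ O := fun x hx =>
    ⟨hx.1.trans_le (hle x), fun u hu v hv hu0 hv0 => hx.2.2 u hu v hv hu0.le hv0.le⟩
  let num : (β → ℝ) → α → ℝ := fun x a => ∑ b ∈ W with φ b = a, max (x b) 0
  have hnum : ∀ x a, num x a ≠ 0 → a ∈ (W.filter fun b => 0 < x b).image φ := by
    intro x a ha
    obtain ⟨b, hb, hb0⟩ := Finset.exists_ne_zero_of_sum_ne_zero ha
    rw [Finset.mem_filter] at hb
    refine Finset.mem_image.2 ⟨b, Finset.mem_filter.2 ⟨hb.1, ?_⟩, hb.2⟩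
    by_contra hcon
    exact hb0 (max_eq_right (not_lt.1 hcon))
  let ρ : O → Realization K := fun x =>
    ⟨fun a => num x a / ∑ v ∈ W, max ((x : β → ℝ) v) 0,
      fun a => div_nonneg (Finset.sum_nonneg fun _ _ => le_max_right _ _) x.2.1.le,
      (W.filter fun b => 0 < (x : β → ℝ) b).image φ, by
        rw [hK]
        refine ⟨fun a ha => ?_, fun u hu v hv hus hvs => ?_⟩
        · obtain ⟨b, hb, rfl⟩ := Finset.mem_image.1 ha
          exact ⟨b, Finset.mem_of_mem_filter _ hb, rfl⟩
        · have key : ∀ w ∈ W, φ w ∈ (W.filter fun b => 0 < (x : β → ℝ) b).image φ →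
              0 < (x : β → ℝ) w := by
            intro w hw hws
            obtain ⟨b, hb, hbw⟩ := Finset.mem_image.1 hws
            rw [Finset.mem_filter] at hb
            exact hφ hb.1 hw hbw ▸ hb.2
          exact x.2.2 u hu v hv (key u hu hus) (key v hv hvs), by
        refine ⟨fun a ha => hnum x a fun h0 => ha (by beta_reduce; rw [h0, zero_div]), ?_⟩
        rw [← Finset.sum_div, div_eq_one_iff_eq x.2.1.ne',
          Finset.sum_subset (Finset.image_subset_image (Finset.filter_subset _ _))
            fun a _ ha => not_not.1 fun h0 => ha (hnum x a h0)]
        exact Finset.sum_fiberwise_of_maps_to (fun b hb => Finset.mem_image_of_mem φ hb) _⟩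
  have hρ : Continuous ρ := by
    refine Continuous.subtype_mk (continuous_pi fun a => Continuous.div ?_ ?_ fun x => x.2.1.ne') _
    · exact continuous_finsetSum _ fun b _ =>
        ((continuous_apply b).comp continuous_subtype_val).max continuous_const
    · exact continuous_finsetSum _ fun b _ =>
        ((continuous_apply b).comp continuous_subtype_val).max continuous_const
  have hsum : ∀ p : Realization K, ∑ b ∈ W, p.1 (φ b) = 1 := by
    rintro ⟨p, hp, s, hs, hps, hp1⟩
    have hsW : s ⊆ W.image φ := fun a ha => Finset.mem_image.2 (((hK s).1 hs).1 a ha)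
    change ∑ b ∈ W, p (φ b) = 1
    rw [← hp1, Finset.sum_subset hsW fun a _ ha => not_not.1 fun h0 => ha (hps a h0),
      Finset.sum_image hφ]
  have hind : ∀ p : Realization K, ∀ u ∈ W, ∀ v ∈ W, 0 < p.1 (φ u) → 0 < p.1 (φ v) →
      u ≠ v → ¬ r u v := by
    rintro ⟨p, hp, s, hs, hps, hp1⟩ u hu v hv hu0 hv0
    exact ((hK s).1 hs).2 u hu v hv (hps _ hu0.ne') (hps _ hv0.ne')
  have hδ : (0 : ℝ) < (W.card + 1 : ℝ)⁻¹ := by positivity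
  have hpos : ∀ p : Realization K, ∀ τ ∈ Set.Icc (0 : ℝ) 1,
      0 < ∑ b ∈ W, (p.1 (φ b) - (W.card + 1 : ℝ)⁻¹ * τ) := by
    intro p τ hτ
    rw [Finset.sum_sub_distrib, hsum, Finset.sum_const, nsmul_eq_mul, sub_pos]
    have h1 : (W.card : ℝ) * (W.card + 1 : ℝ)⁻¹ < 1 := by
      rw [← div_eq_mul_inv, div_lt_one (by positivity)]
      linarith
    have h2 : (0 : ℝ) ≤ (W.card : ℝ) * (W.card + 1 : ℝ)⁻¹ := by positivity
    rw [← mul_assoc]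
    nlinarith [hτ.1, hτ.2]
  refine h.isNConnectedSpace hSO hρ
    (H := fun z b => z.1.1 (φ b) - (W.card + 1 : ℝ)⁻¹ * z.2) ?_ ?_ ?_ ?_
  · exact continuous_pi fun b => (((continuous_apply (φ b)).comp continuous_subtype_val).comp
      continuous_fst).sub (continuous_const.mul continuous_snd)
  · intro p τ hτ
    have h0 : 0 ≤ (W.card + 1 : ℝ)⁻¹ * τ := mul_nonneg hδ.le hτ.1
    refine ⟨(hpos p τ hτ).trans_le (hle _), fun u hu v hv hu0 hv0 => hind p u hu v hv ?_ ?_⟩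
    · exact h0.trans_lt (sub_pos.1 hu0)
    · exact h0.trans_lt (sub_pos.1 hv0)
  · intro p
    refine ⟨hpos p 1 ⟨zero_le_one, le_rfl⟩, fun v hv _ => hv,
      fun u hu v hv hu0 hv0 => hind p u hu v hv ?_ ?_⟩
    · exact (by rwa [mul_one] : _ < _).trans_le (sub_nonneg.1 hu0)
    · exact (by rwa [mul_one] : _ < _).trans_le (sub_nonneg.1 hv0)
  · intro p hp0
    refine Subtype.ext (funext fun a => ?_)
    have hmax : ∀ b, max (p.1 (φ b) - (W.card + 1 : ℝ)⁻¹ * 0) 0 = p.1 (φ b) := fun b => by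
      rw [mul_zero, sub_zero, max_eq_left (p.2.1 _)]
    simp only [ρ, num, hmax, hsum, div_one]
    by_cases ha : ∃ b ∈ W, φ b = a
    · obtain ⟨b, hb, rfl⟩ := ha
      refine Finset.sum_eq_single b ?_ fun hb' => (hb' (by simp [hb])).elim
      intro c hc hcb
      rw [Finset.mem_filter] at hc
      exact absurd (hφ hc.1 hb hc.2) hcb
    · rw [Finset.filter_false_of_mem fun b hb hba => ha ⟨b, hb, hba⟩, Finset.sum_empty]
      obtain ⟨s, hs, hps, -⟩ := p.2.2
      by_contra h0
      exact ha (((hK s).1 hs).1 a (hps a (Ne.symm h0)))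

/-- The edge of the hexagonal row encoded by an element of `rowEdges`. -/
def rowEdge (e : ℤ × ℤ) : Sym2 (ℤ × ℤ) :=
  if e.2 = 2 then s((e.1, 0), (e.1, 1)) else s((e.1, e.2), (e.1 + 1, e.2))

lemma edgeIncident_mk {V : Type*} {a b c d : V} :
    EdgeIncident s(a, b) s(c, d) ↔ a = c ∨ a = d ∨ b = c ∨ b = d := by
  simp only [EdgeIncident, Sym2.mem_iff]
  constructor
  · rintro ⟨v, rfl | rfl, h | h⟩ <;> simp [h]
  · rintro (h | h | h | h)
    exacts [⟨a, by simp [h]⟩, ⟨a, by simp [h]⟩, ⟨b, by simp [h]⟩, ⟨b, by simp [h]⟩]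

lemma edgeIncident_rowEdge {t : ℕ} {e f : ℤ × ℤ} (he : e ∈ rowEdges t) (hf : f ∈ rowEdges t) :
    EdgeIncident (rowEdge e) (rowEdge f) ↔ rowIncident e f := by
  obtain ⟨x, k⟩ := e
  obtain ⟨y, l⟩ := f
  rw [mem_rowEdges] at he hf
  unfold rowEdge
  split_ifs <;> simp only [edgeIncident_mk, rowIncident, Prod.mk.injEq, and_true] at * <;>
    omega

lemma injOn_rowEdge (t : ℕ) : Set.InjOn rowEdge (rowEdges t) := by
  rintro ⟨x, k⟩ he ⟨y, l⟩ hf h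
  rw [SetLike.mem_coe, mem_rowEdges] at he hf
  unfold rowEdge at h
  split_ifs at h <;> simp only [Sym2.eq_iff, Prod.mk.injEq, and_true] at * <;>
      omega

lemma mem_edgeSet_polygonChain {t : ℕ} {e : Sym2 (ℤ × ℤ)} :
    e ∈ (polygonChain 3 t).edgeSet ↔ ∃ b ∈ rowEdges t, rowEdge b = e := by
  induction e using Sym2.inductionOn with | _ p q
  obtain ⟨a, b⟩ := p
  obtain ⟨c, d⟩ := q
  simp only [SimpleGraph.mem_edgeSet, polygonChain, SimpleGraph.fromRel_adj, ne_eq,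
    Prod.mk.injEq, Nat.cast_ofNat]
  constructor
  · rintro ⟨-, (h | h) | (h | h)⟩
    · exact ⟨(a, b), mem_rowEdges.2 (by omega), by
        rw [rowEdge, if_neg (by omega), Sym2.eq_iff]
        simp only [Prod.mk.injEq, true_and, and_true]
        omega⟩
    · exact ⟨(a, 2), mem_rowEdges.2 (by omega), by
        rw [rowEdge, if_pos rfl, Sym2.eq_iff]
        simp only [Prod.mk.injEq, true_and]
        omega⟩
    · exact ⟨(c, d), mem_rowEdges.2 (by omega), by
        rw [rowEdge, if_neg (by omega), Sym2.eq_iff]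
        simp only [Prod.mk.injEq, true_and, and_true]
        omega⟩
    · exact ⟨(c, 2), mem_rowEdges.2 (by omega), by
        rw [rowEdge, if_pos rfl, Sym2.eq_iff]
        simp only [Prod.mk.injEq, true_and]
        omega⟩
  · rintro ⟨⟨x, k⟩, hb, h⟩
    rw [mem_rowEdges] at hb
    unfold rowEdge at h
    split_ifs at h <;> simp only [Sym2.eq_iff, Prod.mk.injEq] at h <;>
      rcases h with ⟨⟨h1, h2⟩, h3, h4⟩ | ⟨⟨h1, h2⟩, h3, h4⟩ <;> subst h1 h2 h3 h4 <;> omega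

/-- For every `t ≥ 1`, the matching complex of the `1 × 1 × t`
honeycomb graph (the graph of `t` 6-gons in a line) is at least `(t − 1)`-connected. -/
theorem matchingComplex_honeycomb_1_1_t_connected (t : ℕ) (ht : 1 ≤ t) :
    IsNConnectedSpace (t - 1) (Realization (matchingComplex (polygonChain 3 t))) := by
  refine isNConnectedSpace_realization (injOn_rowEdge t) (r := rowIncident) (fun m => ?_)
    (show t + 1 = t - 1 + 2 by omega ▸ (extendsBelow_rowEdges t).1 le_rfl)
  simp only [matchingComplex, Set.mem_ofPred_eq, mem_edgeSet_polygonChain]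
  refine and_congr_right fun hm => ⟨fun h u hu v hv hum hvm huv => ?_, fun h e he f hf hef => ?_⟩
  · rw [← edgeIncident_rowEdge hu hv]
    exact h hum hvm fun h => huv (injOn_rowEdge t hu hv h)
  · obtain ⟨u, hu, rfl⟩ := hm e he
    obtain ⟨v, hv, rfl⟩ := hm f hf
    rw [edgeIncident_rowEdge hu hv]
    exact h u hu v hv he hf fun h => hef (h ▸ rfl)
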